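/- The following are equivalent: (i) the patterns 213 and 132 are shape-Wilf-equivalent; (ii) for every Young diagram Y, the number of 213-avoiding transversals of Y equals that of its transpose Y^t; (iii) for every Young diagram Y, T(Y) = T(Y'_c) + T(Y''_c), the column-decomposition identity. -/

import Mathlib

/-- A Young diagram of size `n` (coordinates from the bottom-left, as in the paper):
`b i` is the length of the `i`-th row counted from the bottom, for `i < n`.
Rows get longer going up (top row is the largest), the staircase
`Y(n, n-1, ..., 1)` is contained (`i < b i`), and there are `n` columns (`b i ≤ n`). -/
def IsYoungShape (n : ℕ) (b : ℕ → ℕ) : Prop :=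
  (∀ i j : ℕ, i ≤ j → j < n → b i ≤ b j) ∧ ∀ i : ℕ, i < n → i < b i ∧ b i ≤ n

/-- A transversal of the shape `b`, encoded as a permutation sending each column `i`
(from the left) to the row `π i` (from the bottom) of the unique 1 in that column:
every cell `(column i, row π i)` must lie inside the diagram. -/
def IsTransversal (n : ℕ) (b : ℕ → ℕ) (π : Equiv.Perm (Fin n)) : Prop :=
  ∀ i : Fin n, (i : ℕ) < b (π i)

/-- The transversal `π` of the shape `b` contains the pattern `τ`: some `k` of its 1's
form a submatrix of the diagram (all crossing cells inside the diagram) identical to the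
permutation matrix of `τ`. -/
def ShapeContains (n : ℕ) (b : ℕ → ℕ) {k : ℕ} (π : Fin n → Fin n) (τ : Fin k → Fin k) : Prop :=
  ∃ f : Fin k ↪o Fin n,
    (∀ a c : Fin k, τ a < τ c ↔ π (f a) < π (f c)) ∧
    ∀ a c : Fin k, (f a : ℕ) < b (π (f c))

/-- The number of transversals of the shape `b` avoiding the pattern `τ`,
i.e. `|S_Y(τ)|`. -/
noncomputable def shapeAvoidCard (n : ℕ) (b : ℕ → ℕ) {k : ℕ} (τ : Fin k → Fin k) : ℕ :=
  Nat.card {π : Equiv.Perm (Fin n) // IsTransversal n b π ∧ ¬ ShapeContains n b ⇑π τ}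

/-- Shape-Wilf-equivalence: equally many avoiders on every Young diagram. -/
def ShapeWilfEquiv {k l : ℕ} (τ : Fin k → Fin k) (σ : Fin l → Fin l) : Prop :=
  ∀ (n : ℕ) (b : ℕ → ℕ), IsYoungShape n b → shapeAvoidCard n b τ = shapeAvoidCard n b σ

/-- `T Y`: the number of 213-avoiding transversals of the Young diagram `Y`
(the pattern 213 written 0-indexed is `![1,0,2]`). -/
noncomputable def T (n : ℕ) (b : ℕ → ℕ) : ℕ :=
  shapeAvoidCard n b (![1,0,2] : Fin 3 → Fin 3)

/-- The size `k` of the subdiagram `A_C` associated to the bottom cell `C` in column `c`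
(0-indexed) of the Young diagram `b` of size `n`: the 45° ray drawn north-east from the
top-right corner of `C` in the reduction `Y/C` first meets the border of `Y/C` after
passing through `k` cells.  (`k = 0`, i.e. `A_C = ∅`, exactly when the first diagonal
cell is already missing.) -/
noncomputable def rdK (n : ℕ) (b : ℕ → ℕ) (c : ℕ) : ℕ :=
  sInf {s : ℕ | (s = 0 ∧ (n ≤ 1 ∨ b 1 ≤ c + 1)) ∨ (1 ≤ s ∧ b s ≤ c + s + 1)}

/-- The row lengths (from the bottom) of the Young diagram `A_C` for the bottom cell in
column `c`: it occupies rows `1..k` of `Y` and the `k` columns `c+1, ..., c+k`. -/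
noncomputable def rdA (n : ℕ) (b : ℕ → ℕ) (c : ℕ) (t : ℕ) : ℕ :=
  min (rdK n b c) (b (t + 1) - (c + 1))

/-- The row lengths (from the bottom) of the Young diagram `B_C` for the bottom cell in
column `c`: what remains of `Y/C` after deleting the rows and columns of `A_C`;
it has size `n - 1 - k`. -/
noncomputable def rdB (n : ℕ) (b : ℕ → ℕ) (c : ℕ) (r : ℕ) : ℕ :=
  b (rdK n b c + 1 + r) - 1 - rdK n b c

/-- The transpose of the Young diagram `b` of size `n` (reflection across the main
diagonal of the diagram): row `r` from the bottom of the transpose has as many cells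
as column `n-1-r` (from the left) of `b`. -/
def transposeShape (n : ℕ) (b : ℕ → ℕ) (r : ℕ) : ℕ :=
  ((Finset.range n).filter (fun i => n - 1 - r < b i)).card

/-- The row (from the bottom) of the right corner cell `C_t` of `b`: the lowest row
reaching the rightmost column. -/
noncomputable def ccRow (n : ℕ) (b : ℕ → ℕ) : ℕ :=
  sInf {r : ℕ | n ≤ b r}

/-- Column-deletion `Y'_c`: the diagram `Y` with its right corner cell `C_t` deleted. -/
noncomputable def colDel (n : ℕ) (b : ℕ → ℕ) (i : ℕ) : ℕ :=
  if i = ccRow n b then n - 1 else b i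

/-- `T(Y''_c)`: the value of `T` on the column-decomposition summand `Y''_c` of `Y`
associated with the cell `C_{t-1}` directly above the right corner, defined by
transposing the row-decomposition construction: `Y''_c = ((Yᵗ)''_r)ᵗ`, so
`T(Y''_c) = T(A^t) * T(B^t)` for the cross-product `A × B = (Yᵗ)''_r`. -/
noncomputable def cdTermT (n : ℕ) (b : ℕ → ℕ) : ℕ :=
  let bt := transposeShape n b
  let c := bt 0 - 2
  let K := rdK n bt c
  T K (transposeShape K (rdA n bt c)) *
    T (n - 1 - K) (transposeShape (n - 1 - K) (rdB n bt c))

/-- `e` is a transversal of the shape `b` with no occurrence of `213`; for an occurrence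
only the cell in the last column and the lowest row has to be tested. -/
def Avoids213 (n : ℕ) (b : ℕ → ℕ) (e : Equiv.Perm (Fin n)) : Prop :=
  (∀ i : Fin n, (i : ℕ) < b (e i)) ∧
    ∀ i j l, i < j → j < l → e j < e i → e i < e l → ¬ (l : ℕ) < b (e j)

/-- `e` is a transversal of the shape `b` with no occurrence of `132`. -/
def Avoids132 (n : ℕ) (b : ℕ → ℕ) (e : Equiv.Perm (Fin n)) : Prop :=
  (∀ i : Fin n, (i : ℕ) < b (e i)) ∧
    ∀ i j l, i < j → j < l → e i < e l → e l < e j → ¬ (l : ℕ) < b (e i)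

/-- Row lengths weakly increase among the rows `0, …, n - 1`. -/
def RowMono (n : ℕ) (b : ℕ → ℕ) : Prop := ∀ i j : ℕ, i ≤ j → j < n → b i ≤ b j

theorem exists_orderEmbedding_fin_three {α : Type*} [Preorder α] {i j l : α} (hij : i < j)
    (hjl : j < l) : ∃ f : Fin 3 ↪o α, f 0 = i ∧ f 1 = j ∧ f 2 = l := by
  refine ⟨OrderEmbedding.ofStrictMono ![i, j, l] ?_, rfl, rfl, rfl⟩
  rw [Fin.strictMono_iff_lt_succ]
  simp [Fin.forall_fin_succ, hij, hjl]

theorem shapeContains_213_iff {n : ℕ} {b : ℕ → ℕ} (hb : RowMono n b) (e : Equiv.Perm (Fin n)) :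
    ShapeContains n b e (![1,0,2] : Fin 3 → Fin 3) ↔
      ∃ i j l, i < j ∧ j < l ∧ e j < e i ∧ e i < e l ∧ (l : ℕ) < b (e j) := by
  constructor
  · rintro ⟨f, hf, hc⟩
    exact ⟨f 0, f 1, f 2, f.lt_iff_lt.2 (by decide), f.lt_iff_lt.2 (by decide),
      (hf 1 0).1 (by decide), (hf 0 2).1 (by decide), hc 2 1⟩
  · rintro ⟨i, j, l, hij, hjl, h1, h2, h3⟩
    have hmi := hb (e j) (e i) h1.le (e i).2
    have hml := hb (e j) (e l) (h1.trans h2).le (e l).2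
    obtain ⟨f, rfl, rfl, rfl⟩ := exists_orderEmbedding_fin_three hij hjl
    refine ⟨f, ?_, ?_⟩
    · simp [Fin.forall_fin_succ, h1, h2, h1.trans h2, h1.le, h2.le, (h1.trans h2).le]
    · have h4 : f 0 < f 1 := hij
      simp only [Fin.forall_fin_succ, Fin.forall_fin_zero]
      simp
      omega

theorem shapeContains_132_iff {n : ℕ} {b : ℕ → ℕ} (hb : RowMono n b) (e : Equiv.Perm (Fin n)) :
    ShapeContains n b e (![0,2,1] : Fin 3 → Fin 3) ↔
      ∃ i j l, i < j ∧ j < l ∧ e i < e l ∧ e l < e j ∧ (l : ℕ) < b (e i) := by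
  constructor
  · rintro ⟨f, hf, hc⟩
    exact ⟨f 0, f 1, f 2, f.lt_iff_lt.2 (by decide), f.lt_iff_lt.2 (by decide),
      (hf 0 2).1 (by decide), (hf 2 1).1 (by decide), hc 2 0⟩
  · rintro ⟨i, j, l, hij, hjl, h1, h2, h3⟩
    have hmj := hb (e i) (e j) (h1.trans h2).le (e j).2
    have hml := hb (e i) (e l) h1.le (e l).2
    obtain ⟨f, rfl, rfl, rfl⟩ := exists_orderEmbedding_fin_three hij hjl
    refine ⟨f, ?_, ?_⟩
    · simp [Fin.forall_fin_succ, h1, h2, h1.trans h2, h1.le, h2.le, (h1.trans h2).le]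
    · have h4 : f 0 < f 1 := hij
      simp only [Fin.forall_fin_succ, Fin.forall_fin_zero]
      simp
      omega

theorem T_eq_card {n : ℕ} {b : ℕ → ℕ} (hb : RowMono n b) :
    T n b = Nat.card {e // Avoids213 n b e} := by
  refine Nat.card_congr (Equiv.subtypeEquivRight fun e => ?_)
  rw [shapeContains_213_iff hb]
  exact and_congr_right fun _ =>
    ⟨fun h i j l h1 h2 h3 h4 h5 => h ⟨i, j, l, h1, h2, h3, h4, h5⟩,
      fun h ⟨i, j, l, h1, h2, h3, h4, h5⟩ => h i j l h1 h2 h3 h4 h5⟩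

theorem shapeAvoidCard_132_eq_card {n : ℕ} {b : ℕ → ℕ} (hb : RowMono n b) :
    shapeAvoidCard n b (![0,2,1] : Fin 3 → Fin 3) = Nat.card {e // Avoids132 n b e} := by
  refine Nat.card_congr (Equiv.subtypeEquivRight fun e => ?_)
  rw [shapeContains_132_iff hb]
  exact and_congr_right fun _ =>
    ⟨fun h i j l h1 h2 h3 h4 h5 => h ⟨i, j, l, h1, h2, h3, h4, h5⟩,
      fun h ⟨i, j, l, h1, h2, h3, h4, h5⟩ => h i j l h1 h2 h3 h4 h5⟩

theorem T_congr {n : ℕ} {b b' : ℕ → ℕ} (h : ∀ i < n, b i = b' i) : T n b = T n b' := by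
  refine Nat.card_congr (Equiv.subtypeEquivRight fun e => ?_)
  have h' : ∀ r : Fin n, b r = b' r := fun r => h r r.2
  simp only [IsTransversal, ShapeContains, h']

/-! ### Transposition -/

theorem lt_card_filter_range_iff {n i : ℕ} {p : ℕ → Prop} [DecidablePred p]
    (hp : ∀ x y, x ≤ y → y < n → p x → p y) (hi : i < n) :
    i < ((Finset.range n).filter p).card ↔ p (n - 1 - i) := by
  constructor
  · intro h
    by_contra hn
    have hsub : (Finset.range n).filter p ⊆ Finset.Ioo (n - 1 - i) n := by
      intro x hx
      simp only [Finset.mem_filter, Finset.mem_range, Finset.mem_Ioo] at hx ⊢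
      refine ⟨?_, hx.1⟩
      by_contra hlt
      exact hn (hp x _ (not_lt.1 hlt) (by omega) hx.2)
    have := Finset.card_le_card hsub
    rw [Nat.card_Ioo] at this
    omega
  · intro h
    have hsub : Finset.Ico (n - 1 - i) n ⊆ (Finset.range n).filter p := by
      intro x hx
      simp only [Finset.mem_filter, Finset.mem_range, Finset.mem_Ico] at hx ⊢
      exact ⟨hx.2, hp _ x hx.1 hx.2 h⟩
    have := Finset.card_le_card hsub
    rw [Nat.card_Ico] at this
    omega

theorem lt_transposeShape_iff {n : ℕ} {b : ℕ → ℕ} (hb : RowMono n b) {i : ℕ} (hi : i < n)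
    (r : ℕ) : i < transposeShape n b r ↔ n - 1 - r < b (n - 1 - i) :=
  lt_card_filter_range_iff (fun x y hxy hy hx => hx.trans_le (hb x y hxy hy)) hi

theorem transposeShape_le (n : ℕ) (b : ℕ → ℕ) (r : ℕ) : transposeShape n b r ≤ n :=
  (Finset.card_filter_le _ _).trans_eq (Finset.card_range n)

theorem IsYoungShape.rowMono {n : ℕ} {b : ℕ → ℕ} (hb : IsYoungShape n b) : RowMono n b := hb.1

theorem IsYoungShape.transposeShape {n : ℕ} {b : ℕ → ℕ} (hb : IsYoungShape n b) :
    IsYoungShape n (transposeShape n b) := by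
  refine ⟨fun i j hij hj => ?_, fun i hi => ⟨?_, transposeShape_le n b i⟩⟩
  · refine Finset.card_le_card (Finset.monotone_filter_right _ fun x _ hx => ?_)
    omega
  · rw [lt_transposeShape_iff hb.rowMono hi]
    exact (hb.2 _ (by omega)).1

/-- Reflection of a permutation matrix across the main diagonal. -/
def reflectPerm (n : ℕ) : Equiv.Perm (Fin n) ≃ Equiv.Perm (Fin n) :=
  (Equiv.inv _).trans (Fin.revPerm.equivCongr Fin.revPerm)

theorem reflectPerm_apply {n : ℕ} (e : Equiv.Perm (Fin n)) (i : Fin n) :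
    reflectPerm n e (e i).rev = i.rev := by
  simp [reflectPerm]

theorem avoids132_iff_reflectPerm {n : ℕ} {b : ℕ → ℕ} (hb : RowMono n b)
    (e : Equiv.Perm (Fin n)) :
    Avoids132 n b e ↔ Avoids213 n (transposeShape n b) (reflectPerm n e) := by
  have hcell : ∀ i j : Fin n,
      ((e i).rev : ℕ) < transposeShape n b (j.rev : ℕ) ↔ (j : ℕ) < b (e i) := by
    intro i j
    rw [lt_transposeShape_iff hb (Fin.is_lt _), Fin.val_rev, Fin.val_rev,
      show n - 1 - (n - (j + 1)) = (j : ℕ) by omega,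
      show n - 1 - (n - (e i + 1)) = (e i : ℕ) by omega]
  have hsurj : Function.Surjective fun i => (e i).rev :=
    Fin.rev_surjective.comp e.surjective
  refine and_congr ?_ ?_
  · refine Iff.trans ?_ hsurj.forall.symm
    simp only [reflectPerm_apply, hcell]
  · refine Iff.trans ?_ hsurj.forall₃.symm
    simp only [reflectPerm_apply, hcell, Fin.rev_lt_rev]
    exact ⟨fun h i j l h1 h2 h3 h4 => h l i j h4 h3 h2 h1,
      fun h i j l h1 h2 h3 h4 => h j l i h4 h3 h2 h1⟩

theorem shapeAvoidCard_132_eq_T_transposeShape {n : ℕ} {b : ℕ → ℕ} (hb : IsYoungShape n b) :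
    shapeAvoidCard n b (![0,2,1] : Fin 3 → Fin 3) = T n (transposeShape n b) := by
  rw [shapeAvoidCard_132_eq_card hb.rowMono, T_eq_card hb.transposeShape.rowMono]
  exact Nat.card_congr ((reflectPerm n).subtypeEquiv (avoids132_iff_reflectPerm hb.rowMono))

/-! ### Splitting a permutation into two blocks -/

/-- The partition of `Fin m` into the block `c, …, c + k - 1` and its complement, both
identified monotonically with initial segments. -/
noncomputable def blockEquiv {k p m c : ℕ} (hm : k + p = m) (hc : c ≤ p) :
    Fin k ⊕ Fin p ≃ Fin m :=
  Equiv.ofBijective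
    (Sum.elim (fun x => ⟨c + x, by omega⟩)
      (fun y => ⟨if (y : ℕ) < c then y else y + k, by split_ifs <;> omega⟩))
    ((Fintype.bijective_iff_injective_and_card _).2 ⟨by
      rintro (x | x) (y | y) h <;>
        simp only [Sum.elim_inl, Sum.elim_inr, Sum.inl.injEq, Sum.inr.injEq, reduceCtorEq,
          Fin.ext_iff] at h ⊢
      · omega
      all_goals
        split_ifs at h <;> omega, by simp [hm]⟩)

section blockEquiv

variable {k p m c d : ℕ} (hm : k + p = m) (hc : c ≤ p) (hd : d ≤ p)

theorem blockEquiv_inl_val (x : Fin k) : (blockEquiv hm hc (Sum.inl x) : ℕ) = c + x := by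
  simp [blockEquiv]

theorem blockEquiv_inr_val (y : Fin p) :
    (blockEquiv hm hc (Sum.inr y) : ℕ) = if (y : ℕ) < c then (y : ℕ) else y + k := by
  simp [blockEquiv]

/-- The permutation acting as `e₁` from the column block at `c` to the row block at `d`, and as
`e₂` on the complements. -/
noncomputable def joinPerm (e₁ : Equiv.Perm (Fin k)) (e₂ : Equiv.Perm (Fin p)) :
    Equiv.Perm (Fin m) :=
  (blockEquiv hm hc).symm.trans ((Equiv.sumCongr e₁ e₂).trans (blockEquiv hm hd))

theorem joinPerm_inl (e₁ : Equiv.Perm (Fin k)) (e₂ : Equiv.Perm (Fin p)) (x : Fin k) :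
    joinPerm hm hc hd e₁ e₂ (blockEquiv hm hc (Sum.inl x)) =
      blockEquiv hm hd (Sum.inl (e₁ x)) := by
  simp [joinPerm]

theorem joinPerm_inr (e₁ : Equiv.Perm (Fin k)) (e₂ : Equiv.Perm (Fin p)) (y : Fin p) :
    joinPerm hm hc hd e₁ e₂ (blockEquiv hm hc (Sum.inr y)) =
      blockEquiv hm hd (Sum.inr (e₂ y)) := by
  simp [joinPerm]

theorem exists_eq_joinPerm (e : Equiv.Perm (Fin m))
    (he : ∀ i : Fin m, d ≤ (e i : ℕ) → (e i : ℕ) < d + k → c ≤ (i : ℕ) ∧ (i : ℕ) < c + k) :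
    ∃ e₁ e₂, joinPerm hm hc hd e₁ e₂ = e := by
  let σ : Equiv.Perm (Fin k ⊕ Fin p) :=
    (blockEquiv hm hd).trans (e.symm.trans (blockEquiv hm hc).symm)
  have hσ : Set.MapsTo σ (Set.range Sum.inl) (Set.range Sum.inl) := by
    rintro _ ⟨x, rfl⟩
    rcases hs : σ (Sum.inl x) with y | y
    · exact ⟨y, rfl⟩
    · exfalso
      have h1 : e (blockEquiv hm hc (Sum.inr y)) = blockEquiv hm hd (Sum.inl x) := by
        rw [← hs]; simp [σ]
      have h2 := he (blockEquiv hm hc (Sum.inr y))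
      rw [h1, blockEquiv_inl_val, blockEquiv_inr_val] at h2
      have := h2 (by omega) (by omega)
      split_ifs at this <;> omega
  obtain ⟨⟨f₁, f₂⟩, hf⟩ := Equiv.Perm.mem_sumCongrHom_range_of_perm_mapsTo_inl hσ
  refine ⟨f₁⁻¹, f₂⁻¹, Equiv.ext fun i => ?_⟩
  obtain ⟨s, rfl⟩ := (blockEquiv hm hc).surjective i
  have hs : e.symm (blockEquiv hm hd (Equiv.sumCongr f₁⁻¹ f₂⁻¹ s)) = blockEquiv hm hc s := by
    have h : σ (Equiv.sumCongr f₁⁻¹ f₂⁻¹ s) = s := by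
      rw [← hf]
      rcases s with s | s <;> simp
    simpa [σ, Equiv.symm_apply_eq] using h
  simpa [joinPerm] using ((Equiv.symm_apply_eq e).1 hs)

theorem card_eq_mul_card_of_joinPerm {P : Equiv.Perm (Fin m) → Prop}
    {P₁ : Equiv.Perm (Fin k) → Prop} {P₂ : Equiv.Perm (Fin p) → Prop}
    (hP : ∀ e, P e → ∀ i : Fin m, d ≤ (e i : ℕ) → (e i : ℕ) < d + k →
      c ≤ (i : ℕ) ∧ (i : ℕ) < c + k)
    (hj : ∀ e₁ e₂, P (joinPerm hm hc hd e₁ e₂) ↔ P₁ e₁ ∧ P₂ e₂) :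
    Nat.card {e // P e} = Nat.card {e // P₁ e} * Nat.card {e // P₂ e} := by
  rw [← Nat.card_prod]
  refine (Nat.card_congr (Equiv.ofBijective
    (fun e : {e // P₁ e} × {e // P₂ e} =>
      (⟨joinPerm hm hc hd e.1 e.2, (hj _ _).2 ⟨e.1.2, e.2.2⟩⟩ : {e // P e})) ⟨?_, ?_⟩)).symm
  · rintro ⟨⟨e₁, _⟩, ⟨e₂, _⟩⟩ ⟨⟨f₁, _⟩, ⟨f₂, _⟩⟩ h
    have h' : joinPerm hm hc hd e₁ e₂ = joinPerm hm hc hd f₁ f₂ := congrArg Subtype.val h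
    have h₁ : e₁ = f₁ := by
      ext1 x
      have := DFunLike.congr_fun h' (blockEquiv hm hc (Sum.inl x))
      simpa [joinPerm_inl] using this
    have h₂ : e₂ = f₂ := by
      ext1 x
      have := DFunLike.congr_fun h' (blockEquiv hm hc (Sum.inr x))
      simpa [joinPerm_inr] using this
    subst h₁ h₂
    rfl
  · rintro ⟨e, he⟩
    obtain ⟨e₁, e₂, rfl⟩ := exists_eq_joinPerm hm hc hd e (hP e he)
    exact ⟨⟨⟨e₁, ((hj _ _).1 he).1⟩, ⟨e₂, ((hj _ _).1 he).2⟩⟩, rfl⟩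

end blockEquiv

/-- The `1` in the bottom row of `e` lies in column `c`. -/
def BottomAt {n : ℕ} (c : ℕ) (e : Equiv.Perm (Fin n)) : Prop :=
  ∀ i : Fin n, (e i : ℕ) = 0 → (i : ℕ) = c

theorem card_avoids213_bottomAt_eq {m c : ℕ} {b : ℕ → ℕ} (hb : RowMono (m + 1) b) (hcm : c ≤ m)
    (hc : c < b 0) (hc' : c = 0 ∨ c + 1 = b 0) :
    Nat.card {e // Avoids213 (m + 1) b e ∧ BottomAt c e} =
      Nat.card {e // Avoids213 m (fun i => b (i + 1) - 1) e} := by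
  have hm : 1 + m = m + 1 := add_comm _ _
  rw [card_eq_mul_card_of_joinPerm (P₁ := fun _ => True)
    (P₂ := Avoids213 m (fun i => b (i + 1) - 1)) hm hcm (Nat.zero_le m)]
  · simp
  · rintro e ⟨-, he⟩ i - hi
    have := he i (by omega)
    omega
  · intro e₁ e₂
    have hsurj := (blockEquiv hm hcm).surjective
    have hb0 : ∀ r : Fin m, b 0 ≤ b (r + 1) := fun r => hb _ _ (Nat.zero_le _) (by omega)
    simp only [true_and]
    constructor
    · rintro ⟨⟨h, h'⟩, -⟩
      refine ⟨fun i => ?_, fun i j l hij hjl h1 h2 => ?_⟩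
      · have := h (blockEquiv hm hcm (Sum.inr i))
        have := hb0 (e₂ i)
        simp only [joinPerm_inr, blockEquiv_inr_val, not_lt_zero, if_false] at *
        split_ifs at * <;> omega
      · have := h' (blockEquiv hm hcm (Sum.inr i)) (blockEquiv hm hcm (Sum.inr j))
          (blockEquiv hm hcm (Sum.inr l))
        have := hb0 (e₂ j)
        simp only [joinPerm_inr, blockEquiv_inr_val, not_lt_zero, if_false, Fin.lt_def] at *
        split_ifs at * <;> omega
    · rintro ⟨h, h'⟩
      refine ⟨⟨hsurj.forall.2 ?_, hsurj.forall₃.2 ?_⟩, hsurj.forall.2 ?_⟩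
      · rintro (x | x)
        · simp [joinPerm_inl, blockEquiv_inl_val, hc]
        · have : (x : ℕ) < b (e₂ x + 1) - 1 := h x
          have := hb0 (e₂ x)
          simp only [joinPerm_inr, blockEquiv_inr_val, not_lt_zero, if_false]
          split_ifs <;> omega
      · rintro (x | x) (y | y) (z | z) <;>
        simp only [joinPerm_inl, joinPerm_inr, blockEquiv_inl_val, blockEquiv_inr_val,
          not_lt_zero, if_false, Fin.lt_def, Fin.val_eq_zero, add_zero]
        case inr.inr.inr =>
          intro hxy hyz h1 h2
          have : ¬ (z : ℕ) < b (e₂ y + 1) - 1 :=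
            h' x y z (by split_ifs at hxy <;> omega) (by split_ifs at hyz <;> omega)
              (Fin.lt_def.2 (by omega)) (Fin.lt_def.2 (by omega))
          have := hb0 (e₂ y)
          split_ifs <;> omega
        all_goals (try split_ifs) <;> intros <;> first | contradiction | omega
      · rintro (x | x) <;>
        simp [joinPerm_inl, joinPerm_inr, blockEquiv_inl_val, blockEquiv_inr_val]

theorem T_succ_of_le {m : ℕ} {b : ℕ → ℕ} (hb : RowMono (m + 1) b) (hbm : ∀ i < m, b i ≤ m)
    (htop : m < b m) : T (m + 1) b = T m b := by
  have hm : 1 + m = m + 1 := add_comm _ _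
  rw [T_eq_card hb, T_eq_card (fun i j hij hj => hb i j hij (by omega)),
    card_eq_mul_card_of_joinPerm (P₁ := fun _ => True)
    (P₂ := Avoids213 m b) hm (le_refl m) (le_refl m)]
  · simp
  · rintro e ⟨he, -⟩ i hi hi'
    by_contra hcon
    have h2 := he i
    obtain ⟨j, hj⟩ : ∃ j : Fin (m + 1), (j : ℕ) = m := ⟨Fin.last m, rfl⟩
    have h3 := he j
    have h4 : (e j : ℕ) ≠ m := by
      intro h
      have : e j = e i := Fin.ext (by omega)
      have := e.injective this
      subst this
      omega
    have := hbm (e j) (by omega)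
    omega
  · intro e₁ e₂
    have hsurj := (blockEquiv hm (le_refl m)).surjective
    simp only [true_and]
    constructor
    · rintro ⟨h, h'⟩
      refine ⟨fun i => ?_, fun i j l hij hjl h1 h2 => ?_⟩
      · simpa [joinPerm_inr, blockEquiv_inr_val] using h (blockEquiv hm le_rfl (Sum.inr i))
      · have := h' (blockEquiv hm le_rfl (Sum.inr i)) (blockEquiv hm le_rfl (Sum.inr j))
          (blockEquiv hm le_rfl (Sum.inr l))
        simp only [joinPerm_inr, blockEquiv_inr_val, Fin.is_lt, if_true, Fin.lt_def] at *
        exact this hij hjl h1 h2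
    · rintro ⟨h, h'⟩
      refine ⟨hsurj.forall.2 ?_, hsurj.forall₃.2 ?_⟩
      · rintro (x | x)
        · simp [joinPerm_inl, blockEquiv_inl_val, htop]
        · simpa [joinPerm_inr, blockEquiv_inr_val] using h x
      · rintro (x | x) (y | y) (z | z) <;>
        simp only [joinPerm_inl, joinPerm_inr, blockEquiv_inl_val, blockEquiv_inr_val,
          Fin.is_lt, if_true, Fin.lt_def, Fin.val_eq_zero, add_zero]
        case inr.inr.inr => exact h' x y z
        case inr.inr.inl =>
          have := hbm (e₂ y) (e₂ y).2
          omega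
        all_goals omega

/-! ### Row decomposition -/

theorem le_of_forall_perm_lt {n a t s : ℕ} (e : Equiv.Perm (Fin n)) (hat : a + t ≤ n)
    (h : ∀ j : Fin n, a ≤ (j : ℕ) → (j : ℕ) < a + t → (e j : ℕ) < s) : t ≤ s := by
  have := Fintype.card_le_of_injective
    (fun x : Fin t => (⟨e ⟨a + x, by omega⟩, h _ (by simp) (by simp)⟩ : Fin s)) (by
      intro x y hxy
      simp only [Fin.mk.injEq, Fin.val_inj, e.injective.eq_iff] at hxy
      omega)
  simpa using this

theorem Avoids213.mem_block {n c K : ℕ} {b : ℕ → ℕ} {e : Equiv.Perm (Fin n)}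
    (hb : IsYoungShape n b) (hc : c + 1 < b 0) (hKn : K < n) (hK : b K = c + K + 1)
    (hlt : ∀ s, 1 ≤ s → s < K → c + s + 1 < b s) (he : Avoids213 n b e) (hec : BottomAt c e)
    {i : Fin n} (hi : (e i : ℕ) ≤ K) : c ≤ (i : ℕ) ∧ (i : ℕ) < c + K + 1 := by
  obtain ⟨he, hav⟩ := he
  have hKle := (hb.2 K hKn).2
  refine ⟨?_, (he i).trans_le (hK ▸ hb.1 _ _ hi hKn)⟩
  by_contra! hic
  obtain ⟨r, hr⟩ : ∃ r : ℕ, r = (e i : ℕ) := ⟨_, rfl⟩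
  have hej : ∀ j : Fin n, (e j : ℕ) = r → j = i := fun j hj => e.injective (Fin.ext (hj.trans hr))
  obtain ⟨z, hz⟩ : ∃ z : Fin n, (e z : ℕ) = 0 := ⟨e.symm ⟨0, by omega⟩, by simp⟩
  have hzc : (z : ℕ) = c := hec z hz
  have hr0 : r ≠ 0 := fun h => by
    have := hej z (by omega)
    subst this
    omega
  have hnext : (e ⟨c + 1, by omega⟩ : ℕ) < r := by
    by_contra! h
    have h1 : (e ⟨c + 1, by omega⟩ : ℕ) ≠ r := fun h' => by
      have := congrArg Fin.val (hej _ h')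
      simp only at this
      omega
    refine hav i z ⟨c + 1, by omega⟩ (Fin.lt_def.2 (by omega)) (Fin.lt_def.2 (by simp [hzc]))
      (Fin.lt_def.2 (by omega)) (Fin.lt_def.2 (by omega)) ?_
    rw [hz]
    exact hc
  have hex : ∃ j, ∃ h : j < n, c ≤ j ∧ j ≤ c + r ∧ r < (e ⟨j, h⟩ : ℕ) := by
    by_contra! hno
    have := le_of_forall_perm_lt (a := c) (t := r + 1) (s := r) e (by omega) (fun j h1 h2 => by
      have h3 := hno j j.2 h1 (by omega)
      have h4 : (e j : ℕ) ≠ r := fun h' => by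
        have := hej j h'
        subst this
        omega
      simp only [Fin.eta] at h3
      omega)
    omega
  obtain ⟨j, ⟨hjn, hcj, hjr, hrj⟩, hmin⟩ := Nat.findX hex
  have hjc : j ≠ c := fun h => by
    have : (⟨j, hjn⟩ : Fin n) = z := Fin.ext (by simp [h, hzc])
    rw [this] at hrj
    omega
  have hjc' : j ≠ c + 1 := fun h => by
    subst h
    omega
  have hlow : ∀ k : Fin n, c ≤ (k : ℕ) → (k : ℕ) < j → (e k : ℕ) < r := by
    intro k h1 h2
    by_contra! h3
    have h4 : (e k : ℕ) ≠ r := fun h' => by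
      have := hej k h'
      subst this
      omega
    exact hmin k h2 ⟨k.2, h1, by omega, by rw [Fin.eta]; omega⟩
  obtain ⟨k, hck, hkj, hek⟩ : ∃ k : Fin n, c ≤ (k : ℕ) ∧ (k : ℕ) < j ∧ j - c - 1 ≤ (e k : ℕ) := by
    by_contra! hno
    have := le_of_forall_perm_lt (a := c) (t := j - c) (s := j - c - 1) e (by omega)
      (fun k h1 h2 => hno k h1 (by omega))
    omega
  have hk := hlow k hck hkj
  refine hav i k ⟨j, hjn⟩ (Fin.lt_def.2 (by omega)) (Fin.lt_def.2 hkj)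
    (Fin.lt_def.2 (by omega)) (Fin.lt_def.2 (by omega)) ?_
  have h1 := hb.1 (j - c - 1) (e k) hek (e k).2
  have h2 := hlt (j - c - 1) (by omega) (by omega)
  simp only
  omega

theorem rdK_spec {n c : ℕ} {b : ℕ → ℕ} (hb : IsYoungShape n b) (hn : 0 < n) (hc : c + 1 < b 0) :
    1 ≤ rdK n b c ∧ c + rdK n b c < n ∧ b (rdK n b c) = c + rdK n b c + 1 ∧
      ∀ s, 1 ≤ s → s < rdK n b c → c + s + 1 < b s := by
  have hb0 := (hb.2 0 hn).2
  have h01 := hb.1 0 1 zero_le_one (by omega)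
  have hmem : n - 1 - c ∈
      {s : ℕ | (s = 0 ∧ (n ≤ 1 ∨ b 1 ≤ c + 1)) ∨ (1 ≤ s ∧ b s ≤ c + s + 1)} :=
    Or.inr ⟨by omega, by have := (hb.2 (n - 1 - c) (by omega)).2; omega⟩
  have hspec := Nat.sInf_mem ⟨_, hmem⟩
  have hle := Nat.sInf_le hmem
  have hmin := fun s hs => Nat.notMem_of_lt_sInf (m := s)
    (s := {s : ℕ | (s = 0 ∧ (n ≤ 1 ∨ b 1 ≤ c + 1)) ∨ (1 ≤ s ∧ b s ≤ c + s + 1)}) hs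
  change rdK n b c ∈ _ at hspec
  change rdK n b c ≤ _ at hle
  change ∀ s, s < rdK n b c → _ at hmin
  generalize rdK n b c = K at *
  have hlt : ∀ s, 1 ≤ s → s < K → c + s + 1 < b s := by
    intro s h1 h2
    by_contra! h3
    exact hmin s h2 (Or.inr ⟨h1, h3⟩)
  simp only [Set.mem_ofPred_eq] at hspec
  have hK1 : 1 ≤ K ∧ b K ≤ c + K + 1 := by omega
  refine ⟨hK1.1, by omega, le_antisymm hK1.2 ?_, hlt⟩
  obtain rfl | h := eq_or_ne K 1
  · omega
  · have h1 := hlt (K - 1) (by omega) (by omega)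
    have h2 := hb.1 (K - 1) K (by omega) (by omega)
    omega

theorem rdA_rowMono {n c : ℕ} {b : ℕ → ℕ} (hb : IsYoungShape n b) (hn : 0 < n)
    (hc : c + 1 < b 0) : RowMono (rdK n b c) (rdA n b c) := by
  obtain ⟨-, h1, -, -⟩ := rdK_spec hb hn hc
  intro i j hij hj
  have := hb.1 (i + 1) (j + 1) (by omega) (by omega)
  simp only [rdA]
  omega

theorem rdB_rowMono {n c : ℕ} {b : ℕ → ℕ} (hb : IsYoungShape n b) :
    RowMono (n - 1 - rdK n b c) (rdB n b c) := by
  intro i j hij hj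
  have := hb.1 (rdK n b c + 1 + i) (rdK n b c + 1 + j) (by omega) (by omega)
  simp only [rdB]
  omega

theorem isYoungShape_rdA {n c : ℕ} {b : ℕ → ℕ} (hb : IsYoungShape n b) (hn : 0 < n)
    (hc : c + 1 < b 0) : IsYoungShape (rdK n b c) (rdA n b c) := by
  obtain ⟨h0, h1, h2, h3⟩ := rdK_spec hb hn hc
  refine ⟨rdA_rowMono hb hn hc, fun t ht => ⟨?_, min_le_left _ _⟩⟩
  simp only [rdA]
  obtain h | h := eq_or_ne (t + 1) (rdK n b c)
  · rw [h]
    omega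
  · have := h3 (t + 1) (by omega) (by omega)
    omega

theorem isYoungShape_rdB {n c : ℕ} {b : ℕ → ℕ} (hb : IsYoungShape n b) :
    IsYoungShape (n - 1 - rdK n b c) (rdB n b c) := by
  refine ⟨rdB_rowMono hb, fun r hr => ?_⟩
  have := hb.2 (rdK n b c + 1 + r) (by omega)
  simp only [rdB]
  omega

theorem card_avoids213_bottomAt_eq_mul {n c : ℕ} {b : ℕ → ℕ} (hb : IsYoungShape n b)
    (hn : 0 < n) (hc : c + 1 < b 0) :
    Nat.card {e // Avoids213 n b e ∧ BottomAt c e} =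
      T (rdK n b c) (rdA n b c) * T (n - 1 - rdK n b c) (rdB n b c) := by
  obtain ⟨h1, hKn, hK, hlt⟩ := rdK_spec hb hn hc
  have hmonoA := rdA_rowMono hb hn hc
  have hmonoB := rdB_rowMono (c := c) hb
  rw [T_eq_card hmonoA, T_eq_card hmonoB]
  have hA : rdA n b c = fun t => min (rdK n b c + 1) (b (t + 1) - c) - 1 := by
    funext t
    simp only [rdA]
    omega
  have hB : rdB n b c = fun r => b (rdK n b c + 1 + r) - (rdK n b c + 1) := by
    funext r
    simp only [rdB]
    omega
  rw [hA, hB]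
  generalize rdK n b c = K at *
  rw [← card_avoids213_bottomAt_eq (m := K) (c := 0) (b := fun t => min (K + 1) (b t - c))
    (fun i j hij hj => by have := hb.1 i j hij (by omega); simp only; omega) (Nat.zero_le _)
    (by omega) (Or.inl rfl)]
  obtain ⟨p, hp⟩ : ∃ p, p = n - 1 - K := ⟨_, rfl⟩
  rw [← hp]
  have hm : (K + 1) + p = n := by omega
  have hcp : c ≤ p := by omega
  refine card_eq_mul_card_of_joinPerm hm hcp (Nat.zero_le p)
    (fun e he i _ hi => he.1.mem_block hb hc (by omega) hK hlt he.2 (by omega)) ?_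
  intro e₁ e₂
  have hsurj := (blockEquiv hm hcp).surjective
  have hbA : ∀ x : Fin (K + 1), b x ≤ c + K + 1 := fun x =>
    (hb.1 x K (by omega) (by omega)).trans_eq hK
  have hbB : ∀ y : Fin p, c + K + 1 ≤ b (K + 1 + y) := fun y =>
    hK.symm.trans_le (hb.1 K _ (by omega) (by omega))
  have hadd : ∀ y : Fin p, (y : ℕ) + (K + 1) = K + 1 + y := fun y => add_comm _ _
  constructor
  · rintro ⟨⟨h, h'⟩, h''⟩
    refine ⟨⟨⟨fun i => ?_, fun i j l hij hjl hji hil => ?_⟩, fun i hi => ?_⟩,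
      fun i => ?_, fun i j l hij hjl hji hil => ?_⟩
    · have := h (blockEquiv hm hcp (Sum.inl i))
      simp only [joinPerm_inl, blockEquiv_inl_val, zero_add] at this
      simp only
      omega
    · have := h' (blockEquiv hm hcp (Sum.inl i)) (blockEquiv hm hcp (Sum.inl j))
        (blockEquiv hm hcp (Sum.inl l))
      simp only [joinPerm_inl, blockEquiv_inl_val, zero_add, Fin.lt_def] at this
      have := this (by omega) (by omega) hji hil
      simp only
      omega
    · have := h'' (blockEquiv hm hcp (Sum.inl i))
      simp only [joinPerm_inl, blockEquiv_inl_val, zero_add] at this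
      have := this hi
      omega
    · have := h (blockEquiv hm hcp (Sum.inr i))
      have := hbB (e₂ i)
      simp only [joinPerm_inr, blockEquiv_inr_val, not_lt_zero, if_false, hadd] at *
      split_ifs at * <;> omega
    · have := h' (blockEquiv hm hcp (Sum.inr i)) (blockEquiv hm hcp (Sum.inr j))
        (blockEquiv hm hcp (Sum.inr l))
      simp only [joinPerm_inr, blockEquiv_inr_val, not_lt_zero, if_false, hadd,
        Fin.lt_def] at this hij hjl
      have := this (by split_ifs <;> omega) (by split_ifs <;> omega) (by omega) (by omega)
      have := hbB (e₂ j)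
      simp only
      split_ifs at * <;> omega
  · rintro ⟨⟨⟨hA, hA'⟩, hA''⟩, hB, hB'⟩
    simp only at hA hA' hB hB'
    refine ⟨⟨hsurj.forall.2 ?_, hsurj.forall₃.2 ?_⟩, hsurj.forall.2 ?_⟩
    · rintro (x | x)
      · have := hA x
        simp only [joinPerm_inl, blockEquiv_inl_val, zero_add]
        omega
      · have := hB x
        have := hbB (e₂ x)
        simp only [joinPerm_inr, blockEquiv_inr_val, not_lt_zero, if_false, hadd]
        split_ifs <;> omega
    · rintro (x | x) (y | y) (z | z) <;>
        simp only [joinPerm_inl, joinPerm_inr, blockEquiv_inl_val, blockEquiv_inr_val,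
          not_lt_zero, if_false, Fin.lt_def, zero_add, hadd] <;>
        intro hxy hyz hyx hxz
      case inl.inl.inl =>
        have := hA' x y z (Fin.lt_def.2 (by omega)) (Fin.lt_def.2 (by omega))
          (Fin.lt_def.2 hyx) (Fin.lt_def.2 hxz)
        omega
      case inr.inr.inr =>
        have := hB' x y z (Fin.lt_def.2 (by split_ifs at hxy <;> omega))
          (Fin.lt_def.2 (by split_ifs at hyz <;> omega))
          (Fin.lt_def.2 (by omega)) (Fin.lt_def.2 (by omega))
        have := hbB (e₂ y)
        split_ifs <;> omega
      case inl.inl.inr | inr.inl.inr =>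
        have := hbA (e₁ y)
        split_ifs at * <;> omega
      all_goals omega
    · rintro (x | x)
      · have := hA'' x
        simp only [joinPerm_inl, blockEquiv_inl_val, zero_add]
        omega
      · simp only [joinPerm_inr, blockEquiv_inr_val, not_lt_zero, if_false]
        omega

theorem card_avoids213_eq_sum {m : ℕ} {b : ℕ → ℕ} :
    Nat.card {e // Avoids213 (m + 1) b e} =
      ∑ c ∈ Finset.range (b 0), Nat.card {e // Avoids213 (m + 1) b e ∧ BottomAt c e} := by
  classical
  simp only [Nat.card_eq_fintype_card, Fintype.card_subtype]
  rw [Finset.card_eq_sum_card_fiberwise (f := fun e => (e.symm 0 : ℕ)) (t := Finset.range (b 0))]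
  · refine Finset.sum_congr rfl fun c _ => ?_
    rw [Finset.filter_filter]
    congr 1
    ext e
    simp only [Finset.mem_filter, BottomAt, Fin.val_eq_zero_iff]
    refine and_congr_right fun _ => and_congr_right fun _ => ?_
    constructor
    · rintro h i hi
      rw [← h, ← hi, Equiv.symm_apply_apply]
    · intro h
      exact h _ (e.apply_symm_apply 0)
  · intro e he
    simp only [Finset.coe_filter, Set.mem_ofPred_eq, Finset.coe_range, Set.mem_Iio] at he ⊢
    simpa using he.2.1 (e.symm 0)

/-- Row-deletion: the diagram `b` with the last cell of its bottom row deleted. -/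
def rowDel (b : ℕ → ℕ) (i : ℕ) : ℕ := if i = 0 then b 0 - 1 else b i

theorem isYoungShape_rowDel {n : ℕ} {b : ℕ → ℕ} (hb : IsYoungShape n b) (h2 : 2 ≤ b 0) :
    IsYoungShape n (rowDel b) := by
  refine ⟨fun i j hij hj => ?_, fun i hi => ?_⟩
  · have := hb.1 i j hij hj
    simp only [rowDel]
    split_ifs with hi hj'
    · exact le_rfl
    · subst hi; omega
    · omega
    · exact this
  · have := hb.2 i hi
    simp only [rowDel]
    split_ifs with h
    · subst h; omega
    · exact this

/-- The row-decomposition identity. -/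
theorem T_eq_T_rowDel_add {n : ℕ} {b : ℕ → ℕ} (hb : IsYoungShape n b) (hn : 0 < n)
    (h2 : 2 ≤ b 0) :
    T n b = T n (rowDel b) + T (rdK n b (b 0 - 2)) (rdA n b (b 0 - 2)) *
      T (n - 1 - rdK n b (b 0 - 2)) (rdB n b (b 0 - 2)) := by
  obtain ⟨m, rfl⟩ : ∃ m, n = m + 1 := ⟨n - 1, by omega⟩
  obtain ⟨q, hq⟩ : ∃ q, b 0 = q + 2 := ⟨b 0 - 2, by omega⟩
  have hb' := isYoungShape_rowDel hb h2
  have hq' : rowDel b 0 = q + 1 := by simp [rowDel, hq]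
  have hqm : q + 2 ≤ m + 1 := hq ▸ (hb.2 0 hn).2
  have hsucc : ∀ i, rowDel b (i + 1) = b (i + 1) := fun i => by simp [rowDel]
  have hrdK : ∀ c < q, rdK (m + 1) (rowDel b) c = rdK (m + 1) b c := by
    intro c hc
    unfold rdK
    congr 1
    ext s
    rcases s with _ | s <;> simp [rowDel]
  rw [← card_avoids213_bottomAt_eq_mul hb hn (by omega), T_eq_card hb.rowMono,
    T_eq_card hb'.rowMono, card_avoids213_eq_sum, card_avoids213_eq_sum, hq, hq',
    Finset.sum_range_succ, Finset.sum_range_succ, Finset.sum_range_succ]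
  have hlast : Nat.card {e // Avoids213 (m + 1) b e ∧ BottomAt (q + 1) e} =
      Nat.card {e // Avoids213 (m + 1) (rowDel b) e ∧ BottomAt q e} := by
    rw [card_avoids213_bottomAt_eq hb.rowMono (by omega) (by omega) (Or.inr hq.symm),
      card_avoids213_bottomAt_eq hb'.rowMono (by omega) (by omega) (Or.inr hq'.symm)]
    simp only [hsucc]
  have hsum : ∀ c ∈ Finset.range q,
      Nat.card {e // Avoids213 (m + 1) b e ∧ BottomAt c e} =
        Nat.card {e // Avoids213 (m + 1) (rowDel b) e ∧ BottomAt c e} := by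
    intro c hc
    have hcq := Finset.mem_range.1 hc
    have hK := hrdK c hcq
    have hA : rdA (m + 1) (rowDel b) c = rdA (m + 1) b c := by
      funext t
      simp only [rdA, hK, hsucc]
    have hB : rdB (m + 1) (rowDel b) c = rdB (m + 1) b c := by
      funext r
      simp only [rdB, hK, add_right_comm _ 1 r, hsucc]
    rw [card_avoids213_bottomAt_eq_mul hb hn (by omega),
      card_avoids213_bottomAt_eq_mul hb' hn (by omega), hA, hB, hK]
  rw [hlast, Finset.sum_congr rfl hsum, Nat.add_sub_cancel]
  omega

/-! ### Column deletion -/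

theorem ccRow_spec {n : ℕ} {b : ℕ → ℕ} (hb : IsYoungShape n b) (h2 : 2 ≤ transposeShape n b 0) :
    ccRow n b + 1 < n ∧ b (ccRow n b) = n ∧ ∀ i < ccRow n b, b i < n := by
  have hn : 2 ≤ n := h2.trans (transposeShape_le n b 0)
  have h := (lt_transposeShape_iff hb.rowMono (i := 1) (by omega) 0).1 h2
  have hmem : n - 1 - 1 ∈ {r : ℕ | n ≤ b r} := by
    simp only [Set.mem_ofPred_eq]
    omega
  have hle : ccRow n b ≤ n - 1 - 1 := Nat.sInf_le hmem
  have hge : n ≤ b (ccRow n b) := Nat.sInf_mem ⟨_, hmem⟩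
  exact ⟨by omega, le_antisymm (hb.2 _ (by omega)).2 hge,
    fun i hi => not_le.1 (Nat.notMem_of_lt_sInf (s := {r : ℕ | n ≤ b r}) hi)⟩

theorem isYoungShape_colDel {n : ℕ} {b : ℕ → ℕ} (hb : IsYoungShape n b)
    (h2 : 2 ≤ transposeShape n b 0) : IsYoungShape n (colDel n b) := by
  obtain ⟨h1, hr, hlt⟩ := ccRow_spec hb h2
  refine ⟨fun i j hij hj => ?_, fun i hi => ?_⟩
  · have h3 := hb.1 i j hij hj
    have h4 := hlt i
    simp only [colDel]
    split_ifs with hi' hj' hj'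
    · exact le_rfl
    · subst hi'; omega
    · have := h4 (by omega)
      omega
    · exact h3
  · have := hb.2 i hi
    simp only [colDel]
    split_ifs with h <;> omega

theorem transposeShape_colDel {n : ℕ} {b : ℕ → ℕ} (hb : IsYoungShape n b)
    (h2 : 2 ≤ transposeShape n b 0) :
    transposeShape n (colDel n b) = rowDel (transposeShape n b) := by
  obtain ⟨h1, hr, -⟩ := ccRow_spec hb h2
  funext r
  simp only [rowDel]
  split_ifs with h
  · subst h
    have hmem : ccRow n b ∈ (Finset.range n).filter (fun i => n - 1 - 0 < b i) := by
      simp only [Finset.mem_filter, Finset.mem_range]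
      omega
    rw [transposeShape, transposeShape, ← Finset.card_erase_of_mem hmem]
    congr 1
    ext i
    rw [Finset.mem_filter, Finset.mem_erase, Finset.mem_filter, Finset.mem_range]
    simp only [colDel]
    split_ifs with h
    · omega
    · simp [h]
  · rw [transposeShape, transposeShape]
    congr 1
    refine Finset.filter_congr fun i _ => ?_
    simp only [colDel]
    split_ifs with h
    · subst h
      omega
    · rfl

theorem sum_colDel_lt {n : ℕ} {b : ℕ → ℕ} (hb : IsYoungShape n b)
    (h2 : 2 ≤ transposeShape n b 0) :
    ∑ i ∈ Finset.range n, colDel n b i < ∑ i ∈ Finset.range n, b i := by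
  obtain ⟨h1, hr, -⟩ := ccRow_spec hb h2
  refine Finset.sum_lt_sum (fun i _ => ?_) ⟨ccRow n b, Finset.mem_range.2 (by omega), ?_⟩
  · simp only [colDel]
    split_ifs with h
    · subst h
      omega
    · exact le_rfl
  · simp only [colDel, if_true]
    omega

/-- If the rightmost column consists of a single cell, the transpose of the diagram without
its top row and rightmost column is the transpose without its bottom row and first column. -/
theorem T_transposeShape_succ_eq {m : ℕ} {b : ℕ → ℕ} (hb : IsYoungShape (m + 1) b)
    (h1 : transposeShape (m + 1) b 0 = 1) :
    T (m + 1) (transposeShape (m + 1) b) = T m (transposeShape m b) := by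
  have hbt := hb.transposeShape
  have hshift : ∀ i < m, transposeShape (m + 1) b (i + 1) - 1 = transposeShape m b i := by
    intro i hi
    have hbm := (hb.2 m (by omega)).1
    rw [transposeShape, transposeShape, Finset.range_add_one, Finset.filter_insert,
      if_pos (by omega), Finset.card_insert_of_notMem (by simp), Nat.add_sub_cancel,
      show m + 1 - 1 - (i + 1) = m - 1 - i by omega]
  rw [← T_congr hshift, T_eq_card hbt.rowMono, card_avoids213_eq_sum, h1, Finset.sum_range_one,
    card_avoids213_bottomAt_eq hbt.rowMono (Nat.zero_le m) (by omega) (Or.inl rfl), T_eq_card]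
  intro i j hij hj
  have := hbt.1 (i + 1) (j + 1) (by omega) (by omega)
  simp only
  omega

theorem isYoungShape_pred {m : ℕ} {b : ℕ → ℕ} (hb : IsYoungShape (m + 1) b)
    (h1 : transposeShape (m + 1) b 0 = 1) : IsYoungShape m b := by
  refine ⟨fun i j hij hj => hb.1 i j hij (by omega), fun i hi => ⟨(hb.2 i (by omega)).1, ?_⟩⟩
  have h2 := lt_transposeShape_iff hb.rowMono (i := 1) (by omega) 0
  have h3 := hb.1 i (m + 1 - 1 - 1) (by omega) (by omega)
  omega

theorem T_transposeShape_eq_of_colDecomp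
    (h : ∀ (n : ℕ) (b : ℕ → ℕ), IsYoungShape n b → 2 ≤ transposeShape n b 0 →
      T n b = T n (colDel n b) + cdTermT n b) (n : ℕ) :
    ∀ b : ℕ → ℕ, IsYoungShape n b → T n b = T n (transposeShape n b) := by
  induction n using Nat.strong_induction_on with
  | _ n ihn =>
  intro b
  induction hs : ∑ i ∈ Finset.range n, b i using Nat.strong_induction_on generalizing b with
  | _ s ihs =>
  intro hb
  obtain rfl | hn := Nat.eq_zero_or_pos n
  · exact T_congr (by simp)
  have hbt := hb.transposeShape
  by_cases h2 : 2 ≤ transposeShape n b 0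
  · obtain ⟨-, hK, -, -⟩ := rdK_spec (c := transposeShape n b 0 - 2) hbt hn (by omega)
    rw [h n b hb h2, T_eq_T_rowDel_add hbt hn h2, cdTermT,
      ihs _ (hs ▸ sum_colDel_lt hb h2) _ rfl (isYoungShape_colDel hb h2),
      transposeShape_colDel hb h2,
      ihn _ (by omega) _ (isYoungShape_rdA hbt hn (by omega)),
      ihn _ (by omega) _ (isYoungShape_rdB hbt)]
  · have h1 : transposeShape n b 0 = 1 := by
      have := (hbt.2 0 hn).1
      omega
    obtain ⟨m, rfl⟩ : ∃ m, n = m + 1 := ⟨n - 1, by omega⟩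
    have hb' := isYoungShape_pred hb h1
    rw [T_transposeShape_succ_eq hb h1, ← ihn m (by omega) b hb',
      T_succ_of_le hb.rowMono (fun i hi => (hb'.2 i hi).2) (hb.2 m (by omega)).1]

theorem colDecomp_of_T_transposeShape_eq
    (h : ∀ (n : ℕ) (b : ℕ → ℕ), IsYoungShape n b → T n b = T n (transposeShape n b))
    {n : ℕ} {b : ℕ → ℕ} (hb : IsYoungShape n b) (h2 : 2 ≤ transposeShape n b 0) :
    T n b = T n (colDel n b) + cdTermT n b := by
  have hbt := hb.transposeShape
  have hn : 0 < n := by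
    have := transposeShape_le n b 0
    omega
  rw [h n b hb, T_eq_T_rowDel_add hbt hn h2, h n _ (isYoungShape_colDel hb h2),
    transposeShape_colDel hb h2, cdTermT, h _ _ (isYoungShape_rdA hbt hn (by omega)),
    h _ _ (isYoungShape_rdB hbt)]

/-- The following are equivalent: (i) 213 and 132 are shape-Wilf-equivalent;
(ii) `T(Y) = T(Yᵗ)` for every Young diagram `Y`;
(iii) the column-decomposition identity `T(Y) = T(Y'_c) + T(Y''_c)` holds for every
Young diagram `Y` (whose rightmost column has at least two cells, so that the cell
`C_{t-1}` above the right corner exists). -/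
theorem equiv_swe_transpose_colDecomp :
    List.TFAE
      [ShapeWilfEquiv (![1,0,2] : Fin 3 → Fin 3) (![0,2,1] : Fin 3 → Fin 3),
       ∀ (n : ℕ) (b : ℕ → ℕ), IsYoungShape n b → T n b = T n (transposeShape n b),
       ∀ (n : ℕ) (b : ℕ → ℕ), IsYoungShape n b → 2 ≤ transposeShape n b 0 →
         T n b = T n (colDel n b) + cdTermT n b] := by
  tfae_have 1 ↔ 2 := by
    refine forall₃_congr fun n b hb => ?_
    rw [shapeAvoidCard_132_eq_T_transposeShape hb]
    rfl
  tfae_have 2 → 3 := fun h n b hb h2 => colDecomp_of_T_transposeShape_eq h hb h2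
  tfae_have 3 → 2 := T_transposeShape_eq_of_colDecomp
  tfae_finish
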